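/- arXiv:2306.10951 — 8 statements merged into one kernel-verified Lean document; each statement's English description precedes it below -/
import Mathlib

section
/- Under HYP-SOC, suppose (p*, h*, f*) is an optimal triple and the demand cap is not binding at the optimum, i.e., (∑ t, h* t) < D. Then the relaxation is exact at every hour: for all t ∈ Fin n, h* t = A*(p* t)^2 + B*(p* t) + C. (Paper's Theorem 1.) -/
/-- Feasibility for the HYP-SOC scheduling problem (electrolyzer on in every hour). -/
def FeasibleSOC (n : ℕ) (W : Fin n → ℝ) (Pmin Pmax D A B C : ℝ)
    (p h f : Fin n → ℝ) : Prop :=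
  (∀ t, f t = W t - p t) ∧
  (∀ t, 0 ≤ f t) ∧
  (∀ t, Pmin ≤ p t ∧ p t ≤ Pmax) ∧
  (∀ t, 0 ≤ h t) ∧
  (∀ t, h t ≤ A * (p t) ^ 2 + B * (p t) + C) ∧
  (∑ t, h t) ≤ D

/-- Objective of the HYP-SOC scheduling problem. -/
def Usoc (n : ℕ) (lam : Fin n → ℝ) (χ : ℝ) (h f : Fin n → ℝ) : ℝ :=
  ∑ t, (lam t * f t + χ * h t)

/-- Theorem 1: if the demand cap is not binding at an optimal solution,
the conic relaxation is exact at every hour. -/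
theorem soc_exact_of_cap_not_binding
    (n : ℕ) (W lam : Fin n → ℝ) (χ : ℝ) (hχ : 0 < χ)
    (Pmin Pmax : ℝ) (hPmin : 0 ≤ Pmin) (hPmm : Pmin ≤ Pmax) (D : ℝ)
    (A B C : ℝ) (hA : A < 0) (hB : 0 < B)
    (p h f : Fin n → ℝ)
    (hfeas : FeasibleSOC n W Pmin Pmax D A B C p h f)
    (hopt : ∀ p' h' f', FeasibleSOC n W Pmin Pmax D A B C p' h' f' →
      Usoc n lam χ h' f' ≤ Usoc n lam χ h f)
    (hcap : (∑ t, h t) < D) :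
    ∀ t, h t = A * (p t) ^ 2 + B * (p t) + C := by
  obtain ⟨hbal, hf, hp, hh, hq, -⟩ := hfeas
  intro t
  by_contra hne
  have hlt : h t < A * (p t) ^ 2 + B * (p t) + C := lt_of_le_of_ne (hq t) hne
  obtain ⟨ε, hε, hεmin⟩ := exists_between
    (lt_min (sub_pos.mpr hlt) (sub_pos.mpr hcap))
  obtain ⟨hεq, hεD⟩ := lt_min_iff.mp hεmin
  -- Producing `ε` more hydrogen at hour `t` stays feasible and raises the objective by `χ * ε`.
  have hle := hopt p (fun s => h s + if s = t then ε else 0) f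
    ⟨hbal, hf, hp, fun s => ?_, fun s => ?_, ?_⟩
  · simp only [Usoc, mul_add, Finset.sum_add_distrib, mul_ite, mul_zero,
      Finset.sum_ite_eq', Finset.mem_univ, if_true] at hle
    linarith [mul_pos hχ hε]
  · have := hh s
    dsimp only
    split_ifs <;> linarith
  · dsimp only
    split_ifs with hs
    · subst hs
      linarith
    · linarith [hq s]
  · simp only [Finset.sum_add_distrib, Finset.sum_ite_eq', Finset.mem_univ, if_true]
    linarith
end

section
/- Under HYP-SOC, suppose (p*, h*, f*) is an optimal triple. Then at every hour t with strictly positive electricity price λ t > 0 and power consumption strictly above the minimum, Pmin < p* t, the relaxation is exact at t: h* t = A*(p* t)^2 + B*(p* t) + C. In particular, if λ t > 0 and Pmin < p* t hold for all t, the relaxation is exact at every hour, even when the demand cap (∑ t, h* t) ≤ D is binding. (Precise pointwise form of the paper's Theorem 2.) -/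
/-- Theorem 2 (pointwise form): at an optimal solution, at every hour with
strictly positive price and consumption strictly above the minimum,
the conic relaxation is exact, even if the demand cap is binding. -/
theorem soc_exact_of_positive_price
    (n : ℕ) (W lam : Fin n → ℝ) (χ : ℝ) (hχ : 0 < χ)
    (Pmin Pmax : ℝ) (hPmin : 0 ≤ Pmin) (hPmm : Pmin ≤ Pmax) (D : ℝ)
    (A B C : ℝ) (hA : A < 0) (hB : 0 < B)
    (p h f : Fin n → ℝ)
    (hfeas : FeasibleSOC n W Pmin Pmax D A B C p h f)
    (hopt : ∀ p' h' f', FeasibleSOC n W Pmin Pmax D A B C p' h' f' →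
      Usoc n lam χ h' f' ≤ Usoc n lam χ h f) :
    ∀ t, 0 < lam t → Pmin < p t → h t = A * (p t) ^ 2 + B * (p t) + C := by
  obtain ⟨hf, hf0, hp, hh0, hhq, hD⟩ := hfeas
  intro t hlam hpt
  by_contra hne
  have hlt : h t < A * (p t) ^ 2 + B * (p t) + C := lt_of_le_of_ne (hhq t) hne
  have hcont : Continuous fun x : ℝ => A * x ^ 2 + B * x + C := by fun_prop
  -- Consumption at `t` can be lowered slightly, selling the freed power at a positive price.
  obtain ⟨x, ⟨hxq, hxmin⟩, hxp⟩ :=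
    (((((hcont.tendsto (p t)).eventually_const_lt hlt).and
      (eventually_gt_nhds hpt)).filter_mono nhdsWithin_le_nhds).and
      (self_mem_nhdsWithin : Set.Iio (p t) ∈ nhdsWithin (p t) (Set.Iio (p t)))).exists
  have hle : ∀ s, Function.update p t x s ≤ p s :=
    update_le_self_iff.mpr hxp.le
  have hfle : ∀ s, f s ≤ W s - Function.update p t x s := fun s => by
    linarith [hf s, hle s]
  refine (hopt (Function.update p t x) h (fun s => W s - Function.update p t x s)
    ⟨fun _ => rfl, fun s => (hf0 s).trans (hfle s), fun s => ⟨?_, (hle s).trans (hp s).2⟩,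
      hh0, fun s => ?_, hD⟩).not_gt ?_
  · rcases eq_or_ne s t with rfl | hs
    · simpa using hxmin.le
    · simpa [hs] using (hp s).1
  · rcases eq_or_ne s t with rfl | hs
    · simpa using hxq.le
    · simpa [hs] using hhq s
  · refine Finset.sum_lt_sum (fun s _ => ?_) ⟨t, Finset.mem_univ t, ?_⟩
    · rcases eq_or_ne s t with rfl | hs
      · gcongr
        exact hfle s
      · simp [hs, hf s]
    · simp only [Function.update_self, hf t]
      gcongr
end

section
/- Under HYP-SOC, assume additionally 2*A*Pmax + B ≥ 0 (so q(p) = A*p^2 + B*p + C is nondecreasing on (−∞, Pmax]). Let T⁻ = {t : Fin n | λ t ≤ 0} be the hours with non-positive electricity prices. Suppose (p*, h*, f*) is optimal, the demand cap is met entirely within T⁻, i.e., ∑_{t ∈ T⁻} h* t = D, and the maximal possible production in the strictly negative-price hours strictly exceeds the cap, i.e., ∑_{t : λ t < 0} q (min (W t) Pmax) > D. Then there exists at least one hour t ∈ T⁻ at which the relaxation is inexact: h* t < q (p* t). (Precise form of the paper's Theorem 3.) -/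
/-- A concave quadratic is nondecreasing to the left of a point where its derivative is
nonnegative. -/
theorem quadratic_le_quadratic {A B C x y z : ℝ} (hA : A ≤ 0) (hz : 0 ≤ 2 * A * z + B)
    (hxy : x ≤ y) (hyz : y ≤ z) : A * x ^ 2 + B * x + C ≤ A * y ^ 2 + B * y + C := by
  have hslope : 0 ≤ A * (x + y) + B := by nlinarith
  nlinarith [mul_nonneg (sub_nonneg.2 hxy) hslope]

/-- At an optimum, the electrolyzer draws the maximal available power in every hour with a
negative electricity price. -/
theorem eq_min_of_optimal_of_neg_price {n : ℕ} {W lam : Fin n → ℝ} {χ Pmin Pmax D A B C : ℝ}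
    (hA : A ≤ 0) (hmono : 0 ≤ 2 * A * Pmax + B) {p h f : Fin n → ℝ}
    (hfeas : FeasibleSOC n W Pmin Pmax D A B C p h f)
    (hopt : ∀ p' h' f', FeasibleSOC n W Pmin Pmax D A B C p' h' f' →
      Usoc n lam χ h' f' ≤ Usoc n lam χ h f)
    {t : Fin n} (ht : lam t < 0) : p t = min (W t) Pmax := by
  obtain ⟨hf, hf0, hp, hh0, hq, hD⟩ := hfeas
  have hle : p t ≤ min (W t) Pmax := le_min (by linarith [hf t, hf0 t]) (hp t).2
  by_contra hne
  have hlt := lt_of_le_of_ne hle hne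
  set p' := Function.update p t (min (W t) Pmax) with hp'
  have hp't : p' t = min (W t) Pmax := by simp [hp']
  have hp's : ∀ s, s ≠ t → p' s = p s := fun s hs => by simp [hp', hs]
  have hfeas' : FeasibleSOC n W Pmin Pmax D A B C p' h (fun s => W s - p' s) := by
    refine ⟨fun _ => rfl, fun s => ?_, fun s => ?_, hh0, fun s => ?_, hD⟩ <;>
      rcases eq_or_ne s t with rfl | hs
    · simp [hp't]
    · simpa [hp's s hs, hf s] using hf0 s
    · rw [hp't]
      exact ⟨(hp s).1.trans hle, min_le_right _ _⟩
    · simpa only [hp's s hs] using hp s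
    · rw [hp't]
      exact (hq s).trans (quadratic_le_quadratic hA hmono hle (min_le_right _ _))
    · simpa only [hp's s hs] using hq s
  refine (hopt _ _ _ hfeas').not_gt (Finset.sum_lt_sum (fun s _ => ?_) ⟨t, Finset.mem_univ t, ?_⟩)
  · rcases eq_or_ne s t with rfl | hs
    · simp only [hf, hp't]
      nlinarith
    · simp only [hf, hp's s hs, le_refl]
  · simp only [hf, hp't]
    nlinarith

/-- Theorem 3: if the demand cap is met entirely within the non-positive-price
hours and the maximal possible production in the strictly negative-price hours
strictly exceeds the cap, then the relaxation is inexact at some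
non-positive-price hour. -/
theorem soc_inexact_of_negative_prices
    (n : ℕ) (W lam : Fin n → ℝ) (χ : ℝ) (hχ : 0 < χ)
    (Pmin Pmax : ℝ) (hPmin : 0 ≤ Pmin) (hPmm : Pmin ≤ Pmax) (D : ℝ)
    (A B C : ℝ) (hA : A < 0) (hB : 0 < B)
    (hmono : 2 * A * Pmax + B ≥ 0)
    (p h f : Fin n → ℝ)
    (hfeas : FeasibleSOC n W Pmin Pmax D A B C p h f)
    (hopt : ∀ p' h' f', FeasibleSOC n W Pmin Pmax D A B C p' h' f' →
      Usoc n lam χ h' f' ≤ Usoc n lam χ h f)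
    (hbind : ∑ t ∈ Finset.univ.filter (fun t => lam t ≤ 0), h t = D)
    (hover : ∑ t ∈ Finset.univ.filter (fun t => lam t < 0),
      (A * (min (W t) Pmax) ^ 2 + B * (min (W t) Pmax) + C) > D) :
    ∃ t, lam t ≤ 0 ∧ h t < A * (p t) ^ 2 + B * (p t) + C := by
  by_contra! hexact
  have hpow : ∀ t, lam t < 0 → p t = min (W t) Pmax := fun _ ht =>
    eq_min_of_optimal_of_neg_price hA.le hmono hfeas hopt ht
  obtain ⟨-, -, -, hh0, -, hD⟩ := hfeas
  refine hover.not_ge (le_trans (Finset.sum_le_sum fun t ht => ?_)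
    ((Finset.sum_le_univ_sum_of_nonneg hh0).trans hD))
  have ht' := (Finset.mem_filter.1 ht).2
  rw [← hpow t ht']
  exact hexact t ht'.le
end

section
/- Maximal consumption at strictly negative prices: under HYP-SOC, assume additionally 2*A*Pmax + B ≥ 0 (so q(p) = A*p^2 + B*p + C is nondecreasing on (−∞, Pmax]). If (p*, h*, f*) is optimal, then for every hour t with λ t < 0, either f* t = 0 (all available wind is consumed, p* t = W t) or p* t = Pmax. Equivalently, p* t = min (W t) Pmax at every strictly negative-price hour. -/
/-- A concave quadratic is nondecreasing to the left of any point where its derivative is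
nonnegative. -/
theorem quadratic_le_quadratic_of_le {A B C x y b : ℝ} (hA : A ≤ 0) (hb : 0 ≤ 2 * A * b + B)
    (hxy : x ≤ y) (hyb : y ≤ b) :
    A * x ^ 2 + B * x + C ≤ A * y ^ 2 + B * y + C := by
  have hslope : 0 ≤ A * (x + y) + B := by nlinarith
  nlinarith [mul_nonneg (sub_nonneg.2 hxy) hslope]

/-- Maximal consumption at strictly negative prices: at an optimal solution,
in every hour with strictly negative price, either all available wind is
consumed or the electrolyzer runs at capacity; equivalently
`p t = min (W t) Pmax`. -/
theorem soc_max_consumption_at_negative_prices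
    (n : ℕ) (W lam : Fin n → ℝ) (χ : ℝ) (hχ : 0 < χ)
    (Pmin Pmax : ℝ) (hPmin : 0 ≤ Pmin) (hPmm : Pmin ≤ Pmax) (D : ℝ)
    (A B C : ℝ) (hA : A < 0) (hB : 0 < B)
    (hmono : 2 * A * Pmax + B ≥ 0)
    (p h f : Fin n → ℝ)
    (hfeas : FeasibleSOC n W Pmin Pmax D A B C p h f)
    (hopt : ∀ p' h' f', FeasibleSOC n W Pmin Pmax D A B C p' h' f' →
      Usoc n lam χ h' f' ≤ Usoc n lam χ h f) :
    ∀ t, lam t < 0 → (f t = 0 ∨ p t = Pmax) ∧ p t = min (W t) Pmax := by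
  intro t ht
  obtain ⟨hf, hf0, hp, hh, hq, hD⟩ := hfeas
  have hpW : p t ≤ W t := by linarith [hf t, hf0 t]
  have hle : p t ≤ min (W t) Pmax := le_min hpW (hp t).2
  have hmin : p t = min (W t) Pmax := by
    refine hle.antisymm (le_of_not_gt fun hlt => ?_)
    set m := min (W t) Pmax
    have hmW : m ≤ W t := min_le_left _ _
    have hmP : m ≤ Pmax := min_le_right _ _
    let p' := Function.update p t m
    have hfeas' : FeasibleSOC n W Pmin Pmax D A B C p' h (fun s => W s - p' s) := by
      refine ⟨fun _ => rfl, fun s => ?_, fun s => ?_, hh, fun s => ?_, hD⟩ <;>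
        rcases eq_or_ne s t with rfl | hs
      · simpa [p'] using hmW
      · simpa [p', hs, hf s] using hf0 s
      · simpa [p'] using ⟨(hp s).1.trans hle, hmP⟩
      · simpa [p', hs] using hp s
      · simpa [p'] using (hq s).trans (quadratic_le_quadratic_of_le hA.le hmono hle hmP)
      · simpa [p', hs] using hq s
    refine (hopt _ _ _ hfeas').not_gt (Finset.sum_lt_sum (fun s _ => ?_) ⟨t, Finset.mem_univ t, ?_⟩)
    · rcases eq_or_ne s t with rfl | hs
      · simp only [p', Function.update_self, hf s]
        nlinarith
      · simp [p', hs, hf s]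
    · simp only [p', Function.update_self, hf t]
      nlinarith
  refine ⟨?_, hmin⟩
  rcases min_choice (W t) Pmax with hm | hm
  · left
    rw [hf t, hmin, hm, sub_self]
  · right
    rw [hmin, hm]
end

section
/- Strict-improvement perturbation underlying Theorem 2: under HYP-SOC, let (p, h, f) be a feasible triple and suppose there is an hour τ with λ τ > 0, Pmin < p τ, and h τ < A*(p τ)^2 + B*(p τ) + C. Then there exists a feasible triple (p', h, f') with the same hydrogen schedule, differing from (p, f) only at τ (with p' τ < p τ and f' τ > f τ), such that U(p',h,f') > U(p,h,f). In particular, (p, h, f) is not optimal. -/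
/-- A quadratic strictly above `y` at `b` is strictly above `y` somewhere in `(a, b)`. -/
theorem exists_between_lt_quadratic (A B C : ℝ) {a b y : ℝ} (hab : a < b)
    (hy : y < A * b ^ 2 + B * b + C) :
    ∃ x, a < x ∧ x < b ∧ y < A * x ^ 2 + B * x + C := by
  have hcont : Continuous fun x : ℝ => A * x ^ 2 + B * x + C := by fun_prop
  have hev : ∀ᶠ x in nhdsWithin b (Set.Iio b), y < A * x ^ 2 + B * x + C :=
    (hcont.continuousAt.eventually (lt_mem_nhds hy)).filter_mono nhdsWithin_le_nhds
  obtain ⟨x, hx, hax, hxb⟩ := (hev.and (Ioo_mem_nhdsLT hab)).exists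
  exact ⟨x, hax, hxb, hx⟩

/-- Replacing the consumption at one hour by a smaller admissible value keeps feasibility. -/
theorem FeasibleSOC.update {n : ℕ} {W : Fin n → ℝ} {Pmin Pmax D A B C : ℝ}
    {p h f : Fin n → ℝ} (hfeas : FeasibleSOC n W Pmin Pmax D A B C p h f)
    {τ : Fin n} {x : ℝ} (hPx : Pmin ≤ x) (hxp : x ≤ p τ)
    (hx : h τ ≤ A * x ^ 2 + B * x + C) :
    FeasibleSOC n W Pmin Pmax D A B C
      (Function.update p τ x) h (Function.update f τ (W τ - x)) := by
  obtain ⟨hbal, hf, hp, hh, hq, hD⟩ := hfeas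
  refine ⟨fun t => ?_, fun t => ?_, fun t => ?_, hh, fun t => ?_, hD⟩ <;>
    obtain rfl | ht := eq_or_ne t τ
  · simp
  · simpa [ht] using hbal t
  · have := hbal t
    have := hf t
    simp only [Function.update_self]
    linarith
  · simpa [ht] using hf t
  · simpa using ⟨hPx, hxp.trans (hp t).2⟩
  · simpa [ht] using hp t
  · simpa using hx
  · simpa [ht] using hq t

/-- Selling more at one hour with a positive price strictly increases the objective. -/
theorem Usoc_lt_update {n : ℕ} {lam : Fin n → ℝ} (χ : ℝ) (h : Fin n → ℝ) {f : Fin n → ℝ}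
    {τ : Fin n} {y : ℝ} (hlam : 0 < lam τ) (hy : f τ < y) :
    Usoc n lam χ h f < Usoc n lam χ h (Function.update f τ y) := by
  refine Finset.sum_lt_sum (fun t _ => ?_) ⟨τ, Finset.mem_univ τ, ?_⟩
  · obtain rfl | ht := eq_or_ne t τ
    · simpa using mul_le_mul_of_nonneg_left hy.le hlam.le
    · simp [ht]
  · simpa using mul_lt_mul_of_pos_left hy hlam

/-- Strict-improvement perturbation underlying Theorem 2: if at some hour τ the
price is strictly positive, consumption is strictly above the minimum, and the
production constraint is slack, then shifting power from the electrolyzer to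
the grid at τ yields a feasible, strictly better solution; hence (p,h,f) is
not optimal. -/
theorem soc_perturbation_thm2
    (n : ℕ) (W lam : Fin n → ℝ) (χ : ℝ) (hχ : 0 < χ)
    (Pmin Pmax : ℝ) (hPmin : 0 ≤ Pmin) (hPmm : Pmin ≤ Pmax) (D : ℝ)
    (A B C : ℝ) (hA : A < 0) (hB : 0 < B)
    (p h f : Fin n → ℝ)
    (hfeas : FeasibleSOC n W Pmin Pmax D A B C p h f)
    (τ : Fin n) (hlam : 0 < lam τ) (hpτ : Pmin < p τ)
    (hslack : h τ < A * (p τ) ^ 2 + B * (p τ) + C) :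
    (∃ p' f' : Fin n → ℝ,
      FeasibleSOC n W Pmin Pmax D A B C p' h f' ∧
      (∀ t, t ≠ τ → p' t = p t ∧ f' t = f t) ∧
      p' τ < p τ ∧ f τ < f' τ ∧
      Usoc n lam χ h f < Usoc n lam χ h f') ∧
    ¬ (∀ p' h' f', FeasibleSOC n W Pmin Pmax D A B C p' h' f' →
      Usoc n lam χ h' f' ≤ Usoc n lam χ h f) := by
  obtain ⟨x, hPx, hxp, hx⟩ := exists_between_lt_quadratic A B C hpτ hslack
  have hfx : f τ < W τ - x := by
    have := hfeas.1 τ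
    linarith
  have hfeas' := hfeas.update hPx.le hxp.le hx.le
  have hU := Usoc_lt_update χ h hlam hfx
  refine ⟨⟨_, _, hfeas', fun t ht => ?_, ?_, ?_, hU⟩, fun hopt => ?_⟩
  · simp [ht]
  · simpa using hxp
  · simpa using hfx
  · exact (hopt _ _ _ hfeas').not_gt hU
end

section
/- Theorem 1 for the linear relaxation HYP-L: suppose (p*, h*, f*) is an optimal triple for HYP-L and the demand cap is not binding at the optimum, i.e., (∑ t, h* t) < D. Then the relaxation is exact at every hour: for all t ∈ Fin n, h* t = g (p* t), where g(p) is the minimum over segments s ∈ S of Bs s * p + Cs s. -/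
/-- Feasibility for the HYP-L scheduling problem (electrolyzer on in every hour),
with piecewise-linear segments indexed by a finite nonempty type `S`. -/
def FeasibleL (n : ℕ) (W : Fin n → ℝ) (Pmin Pmax D : ℝ)
    (S : Type) [Fintype S] (Bs Cs : S → ℝ)
    (p h f : Fin n → ℝ) : Prop :=
  (∀ t, f t = W t - p t) ∧
  (∀ t, 0 ≤ f t) ∧
  (∀ t, Pmin ≤ p t ∧ p t ≤ Pmax) ∧
  (∀ t, 0 ≤ h t) ∧
  (∀ t, ∀ s : S, h t ≤ Bs s * p t + Cs s) ∧
  (∑ t, h t) ≤ D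

/-- Objective of the HYP-L scheduling problem. -/
def UL (n : ℕ) (lam : Fin n → ℝ) (χ : ℝ) (h f : Fin n → ℝ) : ℝ :=
  ∑ t, (lam t * f t + χ * h t)

/-- The piecewise-linear production bound: minimum over segments. -/
noncomputable def gL (S : Type) [Fintype S] [Nonempty S] (Bs Cs : S → ℝ) (x : ℝ) : ℝ :=
  Finset.univ.inf' Finset.univ_nonempty (fun s => Bs s * x + Cs s)

theorem le_gL_iff (S : Type) [Fintype S] [Nonempty S] (Bs Cs : S → ℝ) (x y : ℝ) :
    y ≤ gL S Bs Cs x ↔ ∀ s, y ≤ Bs s * x + Cs s := by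
  simp [gL, Finset.le_inf'_iff]

theorem UL_add_single (n : ℕ) (lam : Fin n → ℝ) (χ : ℝ) (h f : Fin n → ℝ) (t : Fin n) (ε : ℝ) :
    UL n lam χ (h + Pi.single t ε) f = UL n lam χ h f + χ * ε := by
  simp only [UL, Pi.add_apply, mul_add, Finset.sum_add_distrib, ← Finset.mul_sum,
    Finset.sum_pi_single', Finset.mem_univ, if_true, add_assoc]

/-- Raising production at one hour preserves feasibility as long as neither the production bound
at that hour nor the demand cap is exceeded. -/
theorem FeasibleL.add_single {n : ℕ} {W : Fin n → ℝ} {Pmin Pmax D : ℝ}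
    {S : Type} [Fintype S] [Nonempty S] {Bs Cs : S → ℝ} {p h f : Fin n → ℝ}
    (hfeas : FeasibleL n W Pmin Pmax D S Bs Cs p h f) {t : Fin n} {ε : ℝ} (hε : 0 ≤ ε)
    (hbound : h t + ε ≤ gL S Bs Cs (p t)) (hcap : (∑ u, h u) + ε ≤ D) :
    FeasibleL n W Pmin Pmax D S Bs Cs p (h + Pi.single t ε) f := by
  obtain ⟨hf, hf0, hp, hh0, hseg, -⟩ := hfeas
  refine ⟨hf, hf0, hp, fun u => ?_, fun u => ?_, ?_⟩
  · exact add_nonneg (hh0 u) ((Pi.single_nonneg (i := t)).mpr hε u : (0 : Fin n → ℝ) u ≤ _)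
  · rcases eq_or_ne u t with rfl | hut
    · simpa using (le_gL_iff S Bs Cs _ _).mp hbound
    · simpa [hut] using hseg u
  · simpa [Finset.sum_add_distrib] using hcap

/-- Theorem 1 for HYP-L: if the demand cap is not binding at an optimal
solution, the linear relaxation is exact at every hour. -/
theorem linear_exact_of_cap_not_binding
    (n : ℕ) (W lam : Fin n → ℝ) (χ : ℝ) (hχ : 0 < χ)
    (Pmin Pmax : ℝ) (hPmin : 0 ≤ Pmin) (hPmm : Pmin ≤ Pmax) (D : ℝ)
    (S : Type) [Fintype S] [Nonempty S] (Bs Cs : S → ℝ)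
    (p h f : Fin n → ℝ)
    (hfeas : FeasibleL n W Pmin Pmax D S Bs Cs p h f)
    (hopt : ∀ p' h' f', FeasibleL n W Pmin Pmax D S Bs Cs p' h' f' →
      UL n lam χ h' f' ≤ UL n lam χ h f)
    (hcap : (∑ t, h t) < D) :
    ∀ t, h t = gL S Bs Cs (p t) := by
  intro t
  have hle : h t ≤ gL S Bs Cs (p t) := (le_gL_iff S Bs Cs _ _).mpr (hfeas.2.2.2.2.1 t)
  refine hle.eq_of_not_lt fun hlt => ?_
  obtain ⟨ε, hε, hεmin⟩ : ∃ ε, 0 < ε ∧ ε ≤ min (gL S Bs Cs (p t) - h t) (D - ∑ u, h u) :=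
    ⟨_, lt_min (sub_pos.mpr hlt) (sub_pos.mpr hcap), le_rfl⟩
  obtain ⟨hεg, hεD⟩ := le_min_iff.mp hεmin
  have hU := hopt _ _ _ (hfeas.add_single (t := t) hε.le (by linarith) (by linarith))
  rw [UL_add_single] at hU
  linarith [mul_pos hχ hε]
end

section
/- Theorem 2 for the linear relaxation HYP-L (pointwise form): suppose (p*, h*, f*) is an optimal triple for HYP-L. Then at every hour t with λ t > 0 and Pmin < p* t, the relaxation is exact at t: h* t = g (p* t), where g(p) is the minimum over segments s ∈ S of Bs s * p + Cs s. This holds even when the demand cap (∑ t, h* t) ≤ D is binding. -/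
/-- If all affine functions of a finite family exceed `y` at `x`, they still dominate `y` after
a small enough decrease of `x`. -/
theorem exists_pos_le_affine_sub {S : Type} [Fintype S] [Nonempty S] (Bs Cs : S → ℝ)
    {x y d : ℝ} (hd : 0 < d) (hy : y < gL S Bs Cs x) :
    ∃ ε, 0 < ε ∧ ε ≤ d ∧ ∀ s, y ≤ Bs s * (x - ε) + Cs s := by
  have hM : 0 < ∑ s, |Bs s| + 1 := by positivity
  have hgap : 0 < gL S Bs Cs x - y := sub_pos.mpr hy
  refine ⟨min ((gL S Bs Cs x - y) / (∑ s, |Bs s| + 1)) d,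
    lt_min (div_pos hgap hM) hd, min_le_right _ _, fun s => ?_⟩
  set ε := min ((gL S Bs Cs x - y) / (∑ s, |Bs s| + 1)) d
  have hε : 0 < ε := lt_min (div_pos hgap hM) hd
  have hεM : ε * (∑ s, |Bs s| + 1) ≤ gL S Bs Cs x - y :=
    (le_div_iff₀ hM).mp (min_le_left _ _)
  have hBs : Bs s ≤ ∑ s, |Bs s| + 1 := by
    have := Finset.single_le_sum (fun i _ => abs_nonneg (Bs i)) (Finset.mem_univ s)
    linarith [le_abs_self (Bs s)]
  have hg : gL S Bs Cs x ≤ Bs s * x + Cs s :=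
    Finset.inf'_le (fun s => Bs s * x + Cs s) (Finset.mem_univ s)
  linarith [mul_le_mul_of_nonneg_left hBs hε.le]

/-- Theorem 2 for HYP-L (pointwise form): at an optimal solution, at every hour
with strictly positive price and consumption strictly above the minimum, the
linear relaxation is exact, even if the demand cap is binding. -/
theorem linear_exact_of_positive_price
    (n : ℕ) (W lam : Fin n → ℝ) (χ : ℝ) (hχ : 0 < χ)
    (Pmin Pmax : ℝ) (hPmin : 0 ≤ Pmin) (hPmm : Pmin ≤ Pmax) (D : ℝ)
    (S : Type) [Fintype S] [Nonempty S] (Bs Cs : S → ℝ)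
    (p h f : Fin n → ℝ)
    (hfeas : FeasibleL n W Pmin Pmax D S Bs Cs p h f)
    (hopt : ∀ p' h' f', FeasibleL n W Pmin Pmax D S Bs Cs p' h' f' →
      UL n lam χ h' f' ≤ UL n lam χ h f) :
    ∀ t, 0 < lam t → Pmin < p t → h t = gL S Bs Cs (p t) := by
  intro t hlam hpt
  obtain ⟨hbal, hf, hp, hh, hseg, hD⟩ := hfeas
  refine le_antisymm (Finset.le_inf' _ _ fun s _ => hseg t s) (not_lt.mp fun hlt => ?_)
  obtain ⟨ε, hε, hεd, hεseg⟩ := exists_pos_le_affine_sub Bs Cs (sub_pos.mpr hpt) hlt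
  refine (hopt (Function.update p t (p t - ε)) h (Function.update f t (f t + ε))
    ⟨fun i => ?_, fun i => ?_, fun i => ?_, hh, fun i s => ?_, hD⟩).not_gt ?_
  · rcases eq_or_ne i t with rfl | hi
    · simp only [Function.update_self]
      linarith [hbal i]
    · simpa [hi] using hbal i
  · rcases eq_or_ne i t with rfl | hi
    · simp only [Function.update_self]
      linarith [hf i]
    · simpa [hi] using hf i
  · rcases eq_or_ne i t with rfl | hi
    · simp only [Function.update_self]
      exact ⟨by linarith, by linarith [(hp i).2]⟩
    · simpa [hi] using hp i
  · rcases eq_or_ne i t with rfl | hi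
    · simpa using hεseg s
    · simpa [hi] using hseg i s
  · refine Finset.sum_lt_sum (fun i _ => ?_) ⟨t, Finset.mem_univ t, ?_⟩
    · rcases eq_or_ne i t with rfl | hi
      · simp only [Function.update_self]
        linarith [mul_pos hlam hε]
      · simp [hi]
    · simp only [Function.update_self]
      linarith [mul_pos hlam hε]
end

section
/- Theorem 3 for the linear relaxation HYP-L: assume additionally that every segment slope is non-negative, Bs s ≥ 0 for all s ∈ S (so g is nondecreasing). Let T⁻ = {t : Fin n | λ t ≤ 0}. Suppose (p*, h*, f*) is optimal for HYP-L, ∑_{t ∈ T⁻} h* t = D, and ∑_{t : λ t < 0} g (min (W t) Pmax) > D, where g(p) is the minimum over segments s ∈ S of Bs s * p + Cs s. Then there exists an hour t ∈ T⁻ at which the relaxation is inexact: h* t < g (p* t). -/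
/-- Theorem 3 for HYP-L: with nondecreasing segments, if the demand cap is met
entirely within the non-positive-price hours and the maximal possible
production in the strictly negative-price hours strictly exceeds the cap, then
the relaxation is inexact at some non-positive-price hour. -/
theorem linear_inexact_of_negative_prices
    (n : ℕ) (W lam : Fin n → ℝ) (χ : ℝ) (hχ : 0 < χ)
    (Pmin Pmax : ℝ) (hPmin : 0 ≤ Pmin) (hPmm : Pmin ≤ Pmax) (D : ℝ)
    (S : Type) [Fintype S] [Nonempty S] (Bs Cs : S → ℝ)
    (hmono : ∀ s : S, 0 ≤ Bs s)
    (p h f : Fin n → ℝ)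
    (hfeas : FeasibleL n W Pmin Pmax D S Bs Cs p h f)
    (hopt : ∀ p' h' f', FeasibleL n W Pmin Pmax D S Bs Cs p' h' f' →
      UL n lam χ h' f' ≤ UL n lam χ h f)
    (hbind : ∑ t ∈ Finset.univ.filter (fun t => lam t ≤ 0), h t = D)
    (hover : ∑ t ∈ Finset.univ.filter (fun t => lam t < 0),
      gL S Bs Cs (min (W t) Pmax) > D) :
    ∃ t, lam t ≤ 0 ∧ h t < gL S Bs Cs (p t) := by
  obtain ⟨hf, hf0, hp, hh0, hseg, hD⟩ := hfeas
  by_contra! hexact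
  set q : Fin n → ℝ := fun t => if lam t < 0 then min (W t) Pmax else p t with hq
  have hple : ∀ t, p t ≤ min (W t) Pmax := fun t =>
    le_min (by linarith [hf t, hf0 t]) (hp t).2
  have hpq : ∀ t, p t ≤ q t := by
    intro t
    simp only [hq]
    split_ifs
    · exact hple t
    · exact le_rfl
  have hqle : ∀ t, q t ≤ min (W t) Pmax := by
    intro t
    simp only [hq]
    split_ifs
    · exact le_rfl
    · exact hple t
  have hqfeas : FeasibleL n W Pmin Pmax D S Bs Cs q h (fun t => W t - q t) := by
    refine ⟨fun t => rfl, fun t => ?_, fun t => ⟨(hp t).1.trans (hpq t), ?_⟩, hh0,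
      fun t s => ?_, hD⟩
    · exact sub_nonneg.2 ((hqle t).trans (min_le_left _ _))
    · exact (hqle t).trans (min_le_right _ _)
    · linarith [hseg t s, mul_le_mul_of_nonneg_left (hpq t) (hmono s)]
  have hterm : ∀ t ∈ Finset.univ,
      lam t * f t + χ * h t ≤ lam t * (W t - q t) + χ * h t := by
    intro t _
    rw [hf t]
    by_cases ht : lam t < 0
    · linarith [mul_le_mul_of_nonpos_left (hpq t) ht.le]
    · simp [hq, ht]
  have hsum := (Finset.sum_eq_sum_iff_of_le hterm).1
    (le_antisymm (Finset.sum_le_sum hterm) (hopt _ _ _ hqfeas))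
  have hpmax : ∀ t, lam t < 0 → min (W t) Pmax = p t := by
    intro t ht
    have h1 : lam t * (W t - p t) = lam t * (W t - q t) := by
      have := hsum t (Finset.mem_univ t)
      rw [hf t] at this
      linarith
    have h2 := mul_left_cancel₀ ht.ne h1
    simp only [hq, if_pos ht] at h2
    linarith
  have hneg : ∑ t ∈ Finset.univ.filter (fun t => lam t < 0), gL S Bs Cs (min (W t) Pmax)
      ≤ ∑ t ∈ Finset.univ.filter (fun t => lam t < 0), h t := by
    refine Finset.sum_le_sum fun t ht => ?_
    have ht' := (Finset.mem_filter.1 ht).2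
    rw [hpmax t ht']
    exact hexact t ht'.le
  have hsub : ∑ t ∈ Finset.univ.filter (fun t => lam t < 0), h t
      ≤ ∑ t ∈ Finset.univ.filter (fun t => lam t ≤ 0), h t :=
    Finset.sum_le_sum_of_subset_of_nonneg
      (Finset.monotone_filter_right _ fun _ _ ht => le_of_lt ht) fun t _ _ => hh0 t
  linarith
end
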